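/- Every λ ∈ W^odd admitting a chain of degree d ≤ (1^m) from the identity coset to λ satisfies λ ⪯ δ^j for some j with 1 ≤ j ≤ m. -/

import Mathlib

/-- Roots of `R⁺ \ R_P⁺`: the formal symbols `t_i - t_j`, `t_i + t_j` and `2 t_i`. -/
inductive OddRoot : Type where
  | tminus (i j : ℕ) : OddRoot
  | tplus (i j : ℕ) : OddRoot
  | double (i : ℕ) : OddRoot
deriving DecidableEq

namespace OddRoot

/-- The conditions for a formal symbol to be a root of `R⁺ \ R_P⁺`. -/
def valid (n m : ℕ) : OddRoot → Prop
  | tminus i j => 1 ≤ i ∧ i ≤ m ∧ i < j ∧ j ≤ n + 1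
  | tplus i j => 1 ≤ i ∧ i ≤ m ∧ i < j ∧ j ≤ n + 1
  | double i => 1 ≤ i ∧ i ≤ m

/-- The reflection associated to a root, as a (signed) permutation of the
ground set `{1,…,2n+2}` inside `ℕ`, where `ī = 2n+3-i`. -/
def refl (n : ℕ) : OddRoot → Equiv.Perm ℕ
  | tminus i j => Equiv.swap i j * Equiv.swap (2*n+3-i) (2*n+3-j)
  | tplus i j => Equiv.swap i (2*n+3-j) * Equiv.swap j (2*n+3-i)
  | double i => Equiv.swap i (2*n+3-i)

/-- The degree vector of a root: `deg α k` is the coefficient of the `k`-th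
simple coroot in `α∨`. -/
def deg : OddRoot → ℕ → ℤ
  | tminus i j, k => if i ≤ k ∧ k < j then 1 else 0
  | tplus i j, k => (if i ≤ k then (1:ℤ) else 0) + (if j ≤ k then 1 else 0)
  | double i, k => if i ≤ k then 1 else 0

end OddRoot

/-- The total degree of a chain of roots. -/
def chainDeg (L : List OddRoot) (k : ℕ) : ℤ := (L.map (fun α => α.deg k)).sum

/-- `IsChainTo n m L lam` : the sequence of roots `L = [α₁,…,α_t]` is a chain from the
identity coset to the tuple `lam`, i.e. each `αᵢ` is in `R⁺ \ R_P⁺` and the composite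
`w = s_{α₁} ∘ ⋯ ∘ s_{α_t}` satisfies `w i = lam i` for `1 ≤ i ≤ m`. -/
def IsChainTo (n m : ℕ) (L : List OddRoot) (lam : ℕ → ℕ) : Prop :=
  (∀ α ∈ L, α.valid n m) ∧
  ∀ i ∈ Finset.Icc 1 m, ((L.map (OddRoot.refl n)).prod) i = lam i

/-- `W^odd`: tuples `(lam 1, …, lam m)` of pairwise distinct elements of `{1,…,2n+1}`
with no two entries summing to `2n+3`. -/
def Wodd (n m : ℕ) (lam : ℕ → ℕ) : Prop :=
  (∀ i ∈ Finset.Icc 1 m, lam i ∈ Finset.Icc 1 (2*n+1)) ∧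
  (∀ i ∈ Finset.Icc 1 m, ∀ j ∈ Finset.Icc 1 m, i ≠ j → lam i ≠ lam j) ∧
  (∀ i ∈ Finset.Icc 1 m, ∀ j ∈ Finset.Icc 1 m, lam i + lam j ≠ 2*n+3)

/-- `LamEntry lam k i = Λᵏᵢ`, the `i`-th smallest element of `{lam 1, …, lam k}`. -/
def LamEntry (lam : ℕ → ℕ) (k i : ℕ) : ℕ :=
  (((Finset.Icc 1 k).image lam).sort (· ≤ ·)).getD (i-1) 0

/-- The Bruhat-type order `λ ⪯ δ`: `Λᵏᵢ ≤ Δᵏᵢ` for all `1 ≤ i ≤ k ≤ m`. -/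
def Dominates (m : ℕ) (lam del : ℕ → ℕ) : Prop :=
  ∀ k ∈ Finset.Icc 1 m, ∀ i ∈ Finset.Icc 1 k, LamEntry lam k i ≤ LamEntry del k i

/-- The tuples `δʲ`: `δ¹ = ((m+1)̄ | 2 | 3 | ⋯ | m)` and, for `2 ≤ j ≤ m`,
`δʲ = (j̄ | 2 | ⋯ | j-1 | 1 | j+1 | ⋯ | m)`. -/
def delta (n m j : ℕ) : ℕ → ℕ := fun i =>
  if j = 1 then (if i = 1 then 2*n+2-m else i)
  else if i = 1 then 2*n+3-j else if i = j then 1 else i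

/-- The pattern vector `(0^a 1^b c^(m-a-b))`. -/
def patvec (a b : ℕ) (c : ℤ) : ℕ → ℤ := fun k =>
  if k ≤ a then 0 else if k ≤ a + b then 1 else c

/-- The simple reflections `s_k` (`1 ≤ k ≤ n`, swapping `k ↔ k+1` and `k̄ ↔ (k+1)̄`)
and `s_{n+1}` (swapping `n+1 ↔ (n+1)̄ = n+2`). -/
def simpleRefl (n k : ℕ) : Equiv.Perm ℕ :=
  if k ≤ n then Equiv.swap k (k+1) * Equiv.swap (2*n+3-k) (2*n+2-k)
  else Equiv.swap (n+1) (n+2)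

/-- Number of points of `{1,…,k}` sent outside `{1,…,k}`. -/
def crossing (k : ℕ) (w : Equiv.Perm ℕ) : Finset ℕ :=
  (Finset.Icc 1 k).filter (fun a => w a ∉ Finset.Icc 1 k)

theorem crossing_mul (k : ℕ) (u v : Equiv.Perm ℕ) :
    (crossing k (u * v)).card ≤ (crossing k u).card + (crossing k v).card := by
  have h : crossing k (u * v) ⊆ (crossing k u).image (v⁻¹ : Equiv.Perm ℕ) ∪ crossing k v := by
    intro a ha
    obtain ⟨h1, h2⟩ := Finset.mem_filter.1 ha
    by_cases hv : v a ∈ Finset.Icc 1 k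
    · exact Finset.mem_union_left _
        (Finset.mem_image.2 ⟨v a, Finset.mem_filter.2 ⟨hv, h2⟩, by simp⟩)
    · exact Finset.mem_union_right _ (Finset.mem_filter.2 ⟨h1, hv⟩)
  calc _ ≤ _ := Finset.card_le_card h
    _ ≤ _ := Finset.card_union_le _ _
    _ ≤ _ := Nat.add_le_add_right Finset.card_image_le _

theorem card_crossing_refl (n m k : ℕ) (hmn : m ≤ n) (hk : k ≤ m) (α : OddRoot)
    (hα : α.valid n m) : ((crossing k (α.refl n)).card : ℤ) ≤ α.deg k := by
  cases α with
  | tminus i j =>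
    simp only [OddRoot.valid] at hα
    have h : crossing k ((OddRoot.tminus i j).refl n) ⊆ if i ≤ k ∧ k < j then {i} else ∅ := by
      intro a ha
      simp only [crossing, OddRoot.refl, Finset.mem_filter, Finset.mem_Icc,
        Equiv.Perm.mul_apply] at ha
      obtain ⟨h1, h2⟩ := ha
      rw [Equiv.swap_apply_of_ne_of_ne (a := 2*n+3-i) (by omega) (by omega),
        Equiv.swap_apply_def] at h2
      split_ifs at h2 ⊢ <;> simp <;> omega
    have := Finset.card_le_card h
    simp only [OddRoot.deg]
    split_ifs at this ⊢ <;> simp at this ⊢ <;> omega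
  | tplus i j =>
    simp only [OddRoot.valid] at hα
    have h : crossing k ((OddRoot.tplus i j).refl n) ⊆
        (if i ≤ k then {i} else ∅) ∪ (if j ≤ k then {j} else ∅) := by
      intro a ha
      simp only [crossing, OddRoot.refl, Finset.mem_filter, Finset.mem_Icc,
        Equiv.Perm.mul_apply] at ha
      obtain ⟨h1, h2⟩ := ha
      by_cases hi : a = i
      · subst hi; simp [h1.2]
      by_cases hj : a = j
      · subst hj; simp [h1.2]
      rw [Equiv.swap_apply_of_ne_of_ne (a := j) (by omega) (by omega),
        Equiv.swap_apply_of_ne_of_ne (by omega) (by omega)] at h2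
      exact absurd h1 h2
    have h1 := (Finset.card_le_card h).trans (Finset.card_union_le _ _)
    simp only [OddRoot.deg]
    split_ifs at h1 ⊢ <;> simp only [Finset.card_singleton, Finset.card_empty] at h1 <;> omega
  | double i =>
    simp only [OddRoot.valid] at hα
    have h : crossing k ((OddRoot.double i).refl n) ⊆ if i ≤ k then {i} else ∅ := by
      intro a ha
      simp only [crossing, OddRoot.refl, Finset.mem_filter, Finset.mem_Icc] at ha
      obtain ⟨h1, h2⟩ := ha
      rw [Equiv.swap_apply_def] at h2
      split_ifs at h2 ⊢ <;> simp <;> omega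
    have := Finset.card_le_card h
    simp only [OddRoot.deg]
    split_ifs at this ⊢ <;> simp only [Finset.card_singleton, Finset.card_empty] at this <;> omega

theorem card_crossing_chain (n m k : ℕ) (hmn : m ≤ n) (hk : k ≤ m) (L : List OddRoot)
    (hL : ∀ α ∈ L, α.valid n m) :
    ((crossing k (L.map (OddRoot.refl n)).prod).card : ℤ) ≤ chainDeg L k := by
  induction L with
  | nil =>
    simp [chainDeg, crossing, Finset.filter_eq_empty_iff]
  | cons α L ih =>
    have h1 := ih (fun β hβ => hL β (List.mem_cons_of_mem _ hβ))
    have h2 := card_crossing_refl n m k hmn hk α (hL α List.mem_cons_self)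
    have h3 := crossing_mul k (α.refl n) (L.map (OddRoot.refl n)).prod
    simp only [chainDeg, List.map_cons, List.prod_cons, List.sum_cons] at h1 ⊢
    omega

/-- Comparison of sorted entries from comparison of counting functions. -/
theorem sort_getD_le (S T : Finset ℕ) (hST : S.card = T.card)
    (h : ∀ c, (T.filter (· ≤ c)).card ≤ (S.filter (· ≤ c)).card) (i : ℕ) (hi : i < S.card) :
    (S.sort (· ≤ ·)).getD i 0 ≤ (T.sort (· ≤ ·)).getD i 0 := by
  have hiT : i < T.card := hST ▸ hi
  have eS : (S.sort (· ≤ ·)).getD i 0 = S.orderEmbOfFin rfl ⟨i, hi⟩ := by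
    rw [Finset.orderEmbOfFin_apply, List.getD_eq_getElem _ _ (by simpa using hi)]
    rfl
  have eT : (T.sort (· ≤ ·)).getD i 0 = T.orderEmbOfFin rfl ⟨i, hiT⟩ := by
    rw [Finset.orderEmbOfFin_apply, List.getD_eq_getElem _ _ (by simpa using hiT)]
    rfl
  rw [eS, eT]
  by_contra! hlt
  set c := T.orderEmbOfFin rfl ⟨i, hiT⟩ with hc
  have hS : S.filter (· ≤ c) ⊆ (Finset.Iio (⟨i, hi⟩ : Fin S.card)).image (S.orderEmbOfFin rfl) := by
    intro a ha
    rw [Finset.mem_filter] at ha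
    have : a ∈ Set.range (S.orderEmbOfFin rfl) := by
      rw [Finset.range_orderEmbOfFin]; exact ha.1
    obtain ⟨b, rfl⟩ := this
    refine Finset.mem_image_of_mem _ (Finset.mem_Iio.2 ?_)
    exact (S.orderEmbOfFin rfl).lt_iff_lt.1 (lt_of_le_of_lt ha.2 hlt)
  have hT : (Finset.Iic (⟨i, hiT⟩ : Fin T.card)).image (T.orderEmbOfFin rfl) ⊆
      T.filter (· ≤ c) := by
    intro a ha
    obtain ⟨b, hb, rfl⟩ := Finset.mem_image.1 ha
    refine Finset.mem_filter.2 ⟨Finset.orderEmbOfFin_mem _ _ _, ?_⟩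
    exact (T.orderEmbOfFin rfl).le_iff_le.2 (Finset.mem_Iic.1 hb)
  have h1 := (Finset.card_le_card hS).trans Finset.card_image_le
  have h2 := Finset.card_le_card hT
  rw [Finset.card_image_of_injective _ (T.orderEmbOfFin rfl).injective] at h2
  simp only [Fin.card_Iio, Fin.card_Iic] at h1 h2
  have := h c
  omega

theorem count_le (k M x : ℕ) (S T : Finset ℕ) (hST : S.card = T.card)
    (hx : x ∈ Finset.Icc 1 k) (hM : ∀ a ∈ S, a ≤ M)
    (hT : ∀ a ∈ T, a = M ∨ (a ∈ Finset.Icc 1 k ∧ a ≠ x))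
    (hmiss : (Finset.Icc 1 k \ S).card ≤ 1)
    (hge : ∀ y ∈ Finset.Icc 1 k \ S, x ≤ y) (c : ℕ) :
    (T.filter (· ≤ c)).card ≤ (S.filter (· ≤ c)).card := by
  by_cases hc : M ≤ c
  · rw [Finset.filter_true_of_mem (s := S) (fun a ha => (hM a ha).trans hc), hST]
    exact Finset.card_filter_le _ _
  have hT' : T.filter (· ≤ c) ⊆ ((Finset.Icc 1 k).filter (· ≤ c)).erase x := by
    intro a ha
    rw [Finset.mem_filter] at ha
    rcases hT a ha.1 with h | h
    · omega
    · exact Finset.mem_erase.2 ⟨h.2, Finset.mem_filter.2 ⟨h.1, ha.2⟩⟩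
  by_cases hy : ∃ y ∈ Finset.Icc 1 k \ S, y ≤ c
  · obtain ⟨y, hy, hyc⟩ := hy
    have hxy := hge y hy
    have hsub : ((Finset.Icc 1 k).filter (· ≤ c)).erase y ⊆ S.filter (· ≤ c) := by
      intro a ha
      rw [Finset.mem_erase, Finset.mem_filter] at ha
      refine Finset.mem_filter.2 ⟨?_, ha.2.2⟩
      by_contra haS
      exact ha.1 (Finset.card_le_one.1 hmiss a (Finset.mem_sdiff.2 ⟨ha.2.1, haS⟩) y hy)
    have h1 := Finset.card_le_card hT'
    have h2 := Finset.card_le_card hsub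
    have hxc : x ≤ c := hxy.trans hyc
    rw [Finset.card_erase_of_mem (Finset.mem_filter.2 ⟨hx, hxc⟩)] at h1
    rw [Finset.card_erase_of_mem
      (Finset.mem_filter.2 ⟨(Finset.mem_sdiff.1 hy).1, hyc⟩)] at h2
    omega
  · push Not at hy
    refine Finset.card_le_card fun a ha => ?_
    have h1 := Finset.mem_filter.1 (Finset.mem_of_mem_erase (hT' ha))
    refine Finset.mem_filter.2 ⟨?_, h1.2⟩
    by_contra haS
    have := hy a (Finset.mem_sdiff.2 ⟨h1.1, haS⟩)
    omega

theorem lamEntry_le (n m j k i : ℕ) (lam : ℕ → ℕ) (hmn : m ≤ n) (hj1 : 1 ≤ j) (hjm : j ≤ m)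
    (hk : k ∈ Finset.Icc 1 m) (hi : i ∈ Finset.Icc 1 k)
    (hinj : Set.InjOn lam (Finset.Icc 1 k))
    (hM : ∀ a ∈ Finset.Icc 1 k, lam a ≤ delta n m j 1)
    (hmiss : (Finset.Icc 1 k \ (Finset.Icc 1 k).image lam).card ≤ 1)
    (hj : j ≠ 1 → ∀ a ∈ Finset.Icc 1 k, lam a ≠ j) :
    LamEntry lam k i ≤ LamEntry (delta n m j) k i := by
  rw [Finset.mem_Icc] at hk hi
  have hS : ((Finset.Icc 1 k).image lam).card = k := by
    rw [Finset.card_image_of_injOn hinj]; simp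
  have hT : ((Finset.Icc 1 k).image (delta n m j)).card = k := by
    rw [Finset.card_image_of_injOn]
    · simp
    · intro a ha b hb hab
      simp only [Finset.coe_Icc, Set.mem_Icc] at ha hb
      simp only [delta] at hab
      split_ifs at hab <;> omega
  have hST := hS.trans hT.symm
  refine sort_getD_le _ _ hST ?_ _ (by omega)
  have hMS : ∀ a ∈ (Finset.Icc 1 k).image lam, a ≤ delta n m j 1 := by
    intro a ha
    obtain ⟨b, hb, rfl⟩ := Finset.mem_image.1 ha
    exact hM b hb
  by_cases hx : j ≠ 1 ∧ j ≤ k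
  · refine count_le k (delta n m j 1) j _ _ hST (Finset.mem_Icc.2 ⟨hj1, hx.2⟩) hMS ?_ hmiss ?_
    · intro a ha
      obtain ⟨b, hb, rfl⟩ := Finset.mem_image.1 ha
      rw [Finset.mem_Icc] at hb ⊢
      simp only [delta]
      split_ifs <;> omega
    · intro y hy
      refine le_of_eq (Finset.card_le_one.1 hmiss j ?_ y hy)
      refine Finset.mem_sdiff.2 ⟨Finset.mem_Icc.2 ⟨hj1, hx.2⟩, fun h => ?_⟩
      obtain ⟨b, hb, hbj⟩ := Finset.mem_image.1 h
      exact hj hx.1 b hb hbj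
  · refine count_le k (delta n m j 1) 1 _ _ hST (Finset.mem_Icc.2 (by omega)) hMS ?_ hmiss ?_
    · intro a ha
      obtain ⟨b, hb, rfl⟩ := Finset.mem_image.1 ha
      rw [Finset.mem_Icc] at hb ⊢
      simp only [delta]
      split_ifs <;> omega
    · intro y hy
      exact (Finset.mem_Icc.1 (Finset.mem_sdiff.1 hy).1).1

/-- every `λ ∈ W^odd` reached from the identity coset by a chain of degree
`d ≤ (1^m)` satisfies `λ ⪯ δʲ` for some `1 ≤ j ≤ m`. -/
theorem below_some_delta (n m : ℕ) (hn : 1 ≤ n) (hm : 1 ≤ m) (hmn : m ≤ n)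
    (lam : ℕ → ℕ) (hlam : Wodd n m lam)
    (L : List OddRoot) (hchain : IsChainTo n m L lam)
    (hdeg : ∀ k ∈ Finset.Icc 1 m, chainDeg L k ≤ 1) :
    ∃ j, 1 ≤ j ∧ j ≤ m ∧ Dominates m lam (delta n m j) := by
  obtain ⟨hval, hdist, hsum⟩ := hlam
  have hinj : ∀ k ∈ Finset.Icc 1 m, Set.InjOn lam (Finset.Icc 1 k) := by
    intro k hk a ha b hb hab
    simp only [Finset.coe_Icc, Set.mem_Icc, Finset.mem_Icc] at ha hb hk
    by_contra hne
    exact hdist a (Finset.mem_Icc.2 (by omega)) b (Finset.mem_Icc.2 (by omega)) hne hab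
  have hmiss : ∀ k ∈ Finset.Icc 1 m,
      (Finset.Icc 1 k \ (Finset.Icc 1 k).image lam).card ≤ 1 := by
    intro k hk
    have h1 := card_crossing_chain n m k hmn (Finset.mem_Icc.1 hk).2 L hchain.1
    have h2 := hdeg k hk
    rw [Finset.card_sdiff_comm (by rw [Finset.card_image_of_injOn (hinj k hk)])]
    have h3 : (Finset.Icc 1 k).image lam \ Finset.Icc 1 k ⊆
        (crossing k (L.map (OddRoot.refl n)).prod).image lam := by
      intro a ha
      obtain ⟨ha1, ha2⟩ := Finset.mem_sdiff.1 ha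
      obtain ⟨b, hb, rfl⟩ := Finset.mem_image.1 ha1
      refine Finset.mem_image_of_mem _ (Finset.mem_filter.2 ⟨hb, ?_⟩)
      rw [hchain.2 b (Finset.mem_Icc.2 ?_)]
      · exact ha2
      · rw [Finset.mem_Icc] at hb hk; omega
    have h4 := (Finset.card_le_card h3).trans Finset.card_image_le
    omega
  obtain ⟨p, hp, hmax⟩ := Finset.exists_max_image (Finset.Icc 1 m) lam
    ⟨1, Finset.mem_Icc.2 ⟨le_rfl, hm⟩⟩
  have hpv := Finset.mem_Icc.1 (hval p hp)
  have hsub : ∀ k ∈ Finset.Icc 1 m, ∀ a ∈ Finset.Icc 1 k, a ∈ Finset.Icc 1 m := by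
    intro k hk a ha
    rw [Finset.mem_Icc] at *
    omega
  by_cases hbig : lam p ≤ 2*n+2-m
  · refine ⟨1, le_rfl, hm, fun k hk i hi => ?_⟩
    refine lamEntry_le n m 1 k i lam hmn le_rfl hm hk hi (hinj k hk) (fun a ha => ?_)
      (hmiss k hk) (fun h => absurd rfl h)
    have := hmax a (hsub k hk a ha)
    simp only [delta, if_true]
    omega
  · refine ⟨2*n+3 - lam p, by omega, by omega, fun k hk i hi => ?_⟩
    refine lamEntry_le n m _ k i lam hmn (by omega) (by omega) hk hi (hinj k hk)
      (fun a ha => ?_) (hmiss k hk) (fun _ a ha hc => ?_)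
    · have := hmax a (hsub k hk a ha)
      simp only [delta, if_true]
      split_ifs <;> omega
    · have := hsum a (hsub k hk a ha) p hp
      omega
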